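/- Let a ∈ ℂ, r > 0, and let f be holomorphic on the punctured disc D(a,r) ∖ {a}. If f is integrable over D(a,r) with respect to Lebesgue area measure (∫_{D(a,r)} |f| dA < ∞), then f has at most a first-order pole at a; that is, the function z ↦ (z − a)·f(z) extends to a holomorphic function on all of D(a,r). -/

import Mathlib

open MeasureTheory Filter Topology Set Metric
open scoped ENNReal Real

lemma aux_circle (h : ℂ → ℂ) (ρ t : ℝ) (ht : 0 < t) (htρ : t < ρ)
    (hh : DifferentiableOn ℂ h (ball 0 ρ)) :
    ∫⁻ _ in Ioo (-π) π, ‖h 0‖ₑ ≤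
      ∫⁻ θ in Ioo (-π) π, ‖h (Complex.polarCoord.symm (t, θ))‖ₑ := by
  have hd : DiffContOnCl ℂ h (ball 0 |t|) := by
    rw [abs_of_pos ht]
    exact hh.diffContOnCl_ball (closedBall_subset_ball htρ)
  have h1 := hd.circleAverage
  rw [Real.circleAverage_def] at h1
  have hper : Function.Periodic (fun θ => h (circleMap 0 t θ)) (2 * π) := fun x => by
    simp only [periodic_circleMap 0 t x]
  have h2 := hper.intervalIntegral_add_eq 0 (-π)
  rw [zero_add, show -π + 2 * π = π by ring] at h2
  rw [h2, intervalIntegral.integral_of_le (by linarith [Real.pi_pos]),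
    integral_Ioc_eq_integral_Ioo] at h1
  have h3 : ∀ θ, circleMap 0 t θ = Complex.polarCoord.symm (t, θ) := fun θ => by
    simp [circleMap, Complex.exp_mul_I]
  simp only [h3] at h1
  refine le_trans ?_ (enorm_integral_le_lintegral_enorm _)
  have h4 : ∫ θ in Ioo (-π) π, h (Complex.polarCoord.symm (t, θ)) = (2 * π) • h 0 := by
    rw [← h1, smul_smul, mul_inv_cancel₀ (by positivity), one_smul]
  rw [h4, enorm_smul, setLIntegral_const, Real.volume_Ioo, mul_comm,
    Real.enorm_of_nonneg (by positivity)]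
  apply le_of_eq
  ring_nf

lemma aux_area (h : ℂ → ℂ) (ρ : ℝ) (hh : DifferentiableOn ℂ h (ball 0 ρ)) :
    ‖h 0‖ₑ * volume (ball (0 : ℂ) ρ) ≤ ∫⁻ w in ball 0 ρ, ‖h w‖ₑ := by
  rw [← setLIntegral_const, ← lintegral_indicator measurableSet_ball,
    ← lintegral_indicator measurableSet_ball, ← Complex.lintegral_comp_polarCoord_symm,
    ← Complex.lintegral_comp_polarCoord_symm]
  have hm1 : Measurable ((ball (0 : ℂ) ρ).indicator fun _ => ‖h 0‖ₑ) :=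
    measurable_const.indicator measurableSet_ball
  have hm2 : Measurable ((ball (0 : ℂ) ρ).indicator fun w => ‖h w‖ₑ) := by
    classical
    rw [← Set.piecewise_eq_indicator]
    exact ContinuousOn.measurable_piecewise hh.continuousOn.enorm
      continuousOn_const measurableSet_ball
  have hp : Measurable fun p : ℝ × ℝ => Complex.polarCoord.symm p := by
    simp only [Complex.polarCoord_symm_apply]
    fun_prop
  have key : ∀ g : ℂ → ℝ≥0∞, Measurable g →
      ∫⁻ p in polarCoord.target, ENNReal.ofReal p.1 • g (Complex.polarCoord.symm p) =
      ∫⁻ t in Ioi (0 : ℝ), ENNReal.ofReal t * ∫⁻ θ in Ioo (-π) π,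
        g (Complex.polarCoord.symm (t, θ)) := by
    intro g hg
    have hgp := hg.comp hp
    rw [polarCoord_target, Measure.volume_eq_prod, ← Measure.prod_restrict, lintegral_prod]
    · refine lintegral_congr fun t => ?_
      simp only [smul_eq_mul]
      rw [lintegral_const_mul]
      exact hgp.comp (measurable_const.prodMk measurable_id)
    · refine Measurable.aemeasurable ?_
      simp only [smul_eq_mul]
      exact (measurable_fst.ennreal_ofReal).mul hgp
  rw [key _ hm1, key _ hm2]
  refine setLIntegral_mono' measurableSet_Ioi fun t ht => ?_
  have ht : 0 < t := ht
  gcongr ENNReal.ofReal t * ?_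
  by_cases htρ : t < ρ
  · have hmem : ∀ θ, Complex.polarCoord.symm (t, θ) ∈ ball (0 : ℂ) ρ := fun θ => by
      rw [mem_ball_zero_iff, Complex.norm_polarCoord_symm, abs_of_pos ht]; exact htρ
    simp only [indicator_of_mem (hmem _)]
    exact aux_circle h ρ t ht htρ hh
  · have hmem : ∀ θ, Complex.polarCoord.symm (t, θ) ∉ ball (0 : ℂ) ρ := fun θ => by
      rw [mem_ball_zero_iff, Complex.norm_polarCoord_symm, abs_of_pos ht]; exact htρ
    simp only [indicator_of_notMem (hmem _)]
    exact le_rfl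

lemma aux_area' (f : ℂ → ℂ) (z : ℂ) (ρ : ℝ) (hf : DifferentiableOn ℂ f (ball z ρ)) :
    ‖f z‖ₑ * volume (ball (0 : ℂ) ρ) ≤ ∫⁻ w in ball z ρ, ‖f w‖ₑ := by
  have hpre : (fun w => z + w) ⁻¹' ball z ρ = ball 0 ρ := by
    ext w; simp [mem_ball, dist_eq_norm]
  have h1 := aux_area (fun w => f (z + w)) ρ (hf.comp (by fun_prop) (by
    intro w hw
    rw [← hpre] at hw; exact hw))
  have h2 := (measurePreserving_add_left (volume : Measure ℂ) z).setLIntegral_comp_preimage_emb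
    (MeasurableEquiv.addLeft z).measurableEmbedding (fun w => ‖f w‖ₑ) (ball z ρ)
  rw [hpre] at h2
  rw [← h2]
  simpa using h1


/-- If `f` is holomorphic on the punctured disc `D(a,r) ∖ {a}` and
integrable over `D(a,r)` w.r.t. Lebesgue area measure, then `f` has at most a
first-order pole at `a`: `z ↦ (z - a)·f(z)` extends holomorphically to `D(a,r)`. -/
theorem stmt3 (a : ℂ) (r : ℝ) (hr : 0 < r) (f : ℂ → ℂ)
    (hf : DifferentiableOn ℂ f (Metric.ball a r \ {a}))
    (hint : MeasureTheory.IntegrableOn f (Metric.ball a r)) :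
    ∃ g : ℂ → ℂ, DifferentiableOn ℂ g (Metric.ball a r) ∧
      ∀ z ∈ Metric.ball a r \ {a}, g z = (z - a) * f z := by

  have hin : ∫⁻ x, ‖f x‖ₑ ∂(volume.restrict (ball a r)) ≠ ∞ := hint.hasFiniteIntegral.ne
  have hvol : Tendsto (fun z : ℂ => volume (ball z (‖z - a‖ / 2))) (𝓝[≠] a) (𝓝 0) := by
    simp only [Complex.volume_ball]
    have : Tendsto (fun z : ℂ => ENNReal.ofReal (‖z - a‖ / 2) ^ 2 * NNReal.pi) (𝓝 a) 
        (𝓝 (ENNReal.ofReal (‖a - a‖ / 2) ^ 2 * NNReal.pi)) := by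
      refine ENNReal.Tendsto.mul_const ?_ (Or.inr ENNReal.coe_ne_top)
      refine Continuous.tendsto ?_ a
      exact (ENNReal.continuous_pow 2).comp (ENNReal.continuous_ofReal.comp (by fun_prop))
    simpa using this.mono_left nhdsWithin_le_nhds
  have hlim := tendsto_setLIntegral_zero hin (l := 𝓝[≠] a)
    (s := fun z => ball z (‖z - a‖ / 2))
    (tendsto_of_tendsto_of_tendsto_of_le_of_le tendsto_const_nhds hvol
      (fun _ => zero_le) (fun z => Measure.restrict_apply_le _ _))
  have hbd : ∀ᶠ z in 𝓝[≠] a, ‖(z - a) ^ 2 * f z‖ₑ * (NNReal.pi / 4 : ℝ≥0∞) ≤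
      ∫⁻ x in ball z (‖z - a‖ / 2), ‖f x‖ₑ ∂(volume.restrict (ball a r)) := by
    have hb : ball a (r / 2) ∈ 𝓝[≠] a := nhdsWithin_le_nhds (ball_mem_nhds a (by positivity))
    filter_upwards [hb, self_mem_nhdsWithin] with z hz hza
    have hzr : ‖z - a‖ < r / 2 := by simpa [dist_eq_norm] using hz
    have hpos : 0 < ‖z - a‖ := norm_pos_iff.2 (sub_ne_zero.2 hza)
    have hsub : ball z (‖z - a‖ / 2) ⊆ ball a r \ {a} := by
      intro w hw
      rw [mem_ball, dist_eq_norm] at hw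
      refine ⟨?_, ?_⟩
      · rw [mem_ball, dist_eq_norm]
        have := norm_add_le (w - z) (z - a)
        rw [sub_add_sub_cancel] at this
        linarith
      · rintro rfl
        rw [norm_sub_rev] at hw
        linarith
    rw [Measure.restrict_restrict_of_subset (hsub.trans sdiff_subset)]
    refine le_trans (le_of_eq ?_) (aux_area' f z _ (hf.mono hsub))
    rw [Complex.volume_ball, enorm_mul, enorm_pow, ← ofReal_norm (z - a),
      ENNReal.ofReal_div_of_pos two_pos, ENNReal.div_eq_inv_mul, ENNReal.div_eq_inv_mul, mul_pow,
      ← ENNReal.inv_pow]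
    norm_num
    ring
  have hlim2 : Tendsto (fun z => ‖(z - a) ^ 2 * f z‖ₑ) (𝓝[≠] a) (𝓝 0) := by
    have hc0 : (NNReal.pi / 4 : ℝ≥0∞) ≠ 0 := by
      simp [ENNReal.div_eq_zero_iff, NNReal.pi_ne_zero]
    have hct : (NNReal.pi / 4 : ℝ≥0∞) ≠ ∞ := ENNReal.div_ne_top ENNReal.coe_ne_top (by norm_num)
    have h1 := tendsto_of_tendsto_of_tendsto_of_le_of_le' tendsto_const_nhds hlim
      (Eventually.of_forall fun _ => zero_le) hbd
    have h2 := ENNReal.Tendsto.mul_const (b := (NNReal.pi / 4 : ℝ≥0∞)⁻¹) h1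
      (Or.inr (ENNReal.inv_ne_top.2 hc0))
    simpa only [mul_assoc, ENNReal.mul_inv_cancel hc0 hct, mul_one, zero_mul] using h2
  have hlim3 : Tendsto (fun z => (z - a) ^ 2 * f z) (𝓝[≠] a) (𝓝 0) :=
    tendsto_zero_iff_enorm_tendsto_zero.2 hlim2
  set F : ℂ → ℂ := fun z => (z - a) * f z with hF
  refine ⟨Function.update F a (limUnder (𝓝[≠] a) F), ?_, ?_⟩
  · refine Complex.differentiableOn_update_limUnder_of_isLittleO (ball_mem_nhds a hr)
      (by fun_prop) ?_
    have hne : ∀ᶠ z in 𝓝[≠] a, (z - a)⁻¹ = 0 → F z - F a = 0 := by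
      filter_upwards [self_mem_nhdsWithin] with z hz h0
      exact absurd (inv_eq_zero.1 h0) (sub_ne_zero.2 hz)
    rw [Asymptotics.isLittleO_iff_tendsto' hne]
    refine hlim3.congr fun z => ?_
    simp only [hF, sub_self, zero_mul, sub_zero, div_inv_eq_mul]
    ring
  · intro z hz
    rw [Function.update_of_ne hz.2]
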